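/- arXiv:0904.2582 — 9 statements merged into one kernel-verified Lean document; each statement's English description precedes it below -/
import Mathlib

section
/- If a is an irrational real number then the set 𝓕(a) is infinite. -/
/-- For `a : ℝ`, `Fset a` is the set of `y : ℝ` such that for every `δ > 0` there are
infinitely many pairs of integers `(N, M)` with `M ≥ 1` and `|y - M * (N - M * a)| < δ`. -/
def Fset (a : ℝ) : Set ℝ :=
  {y | ∀ δ > 0,
    {p : ℤ × ℤ | 1 ≤ p.2 ∧ |y - (p.2 : ℝ) * ((p.1 : ℝ) - (p.2 : ℝ) * a)| < δ}.Infinite}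

/-- The indefinite quadratic form `M * (N - M * a)` evaluated at the integer pair `p = (N, M)`. -/
def pairValue (a : ℝ) (p : ℤ × ℤ) : ℝ := (p.2 : ℝ) * ((p.1 : ℝ) - (p.2 : ℝ) * a)

theorem pairValue_smul (a : ℝ) (k : ℤ) (p : ℤ × ℤ) :
    pairValue a (k * p.1, k * p.2) = (k : ℝ) ^ 2 * pairValue a p := by
  simp only [pairValue]
  push_cast
  ring

theorem pairValue_ne_zero {a : ℝ} (ha : Irrational a) {p : ℤ × ℤ} (hp : 1 ≤ p.2) :
    pairValue a p ≠ 0 := by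
  have hM : p.2 ≠ 0 := by omega
  have hM' : (p.2 : ℝ) ≠ 0 := by exact_mod_cast hM
  refine mul_ne_zero hM' fun h => ?_
  exact (ha.intCast_mul hM).ne_int p.1 (by linarith)

theorem mem_Fset_iff {a y : ℝ} :
    y ∈ Fset a ↔ ∀ δ > 0, {p : ℤ × ℤ | 1 ≤ p.2 ∧ |y - pairValue a p| < δ}.Infinite :=
  Iff.rfl

theorem sq_mul_mem_Fset {a y : ℝ} (hy : y ∈ Fset a) {k : ℤ} (hk : 1 ≤ k) :
    (k : ℝ) ^ 2 * y ∈ Fset a := by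
  rw [mem_Fset_iff] at hy ⊢
  intro δ hδ
  have hk0 : (0 : ℝ) < (k : ℝ) ^ 2 := by
    have : (0 : ℝ) < k := by exact_mod_cast hk
    positivity
  have hinj : Function.Injective fun p : ℤ × ℤ => (k * p.1, k * p.2) := by
    rintro ⟨x, z⟩ ⟨x', z'⟩ h
    have hk' : k ≠ 0 := by omega
    simpa [hk'] using h
  refine ((hy (δ / (k : ℝ) ^ 2) (by positivity)).image hinj.injOn).mono ?_
  rintro _ ⟨p, ⟨hp, hpy⟩, rfl⟩
  refine ⟨by nlinarith, ?_⟩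
  rw [pairValue_smul, ← mul_sub, abs_mul, abs_of_pos hk0, mul_comm]
  exact (lt_div_iff₀ hk0).mp hpy

theorem Fset_infinite_of_mem_ne_zero {a y : ℝ} (hy : y ∈ Fset a) (hy0 : y ≠ 0) :
    (Fset a).Infinite := by
  refine Set.infinite_of_injective_forall_mem (f := fun n : ℕ => (((n : ℤ) + 1 : ℤ) : ℝ) ^ 2 * y)
    (fun m n h => ?_) fun n => sq_mul_mem_Fset hy (by omega)
  have h' := mul_right_cancel₀ hy0 h
  rw [sq_eq_sq₀ (by positivity) (by positivity)] at h'
  have : (m : ℤ) + 1 = n + 1 := by exact_mod_cast h'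
  omega

theorem exists_mem_Fset {a : ℝ} (ha : Irrational a) : ∃ y, y ∈ Fset a := by
  set S : Set (ℤ × ℤ) := {p | 1 ≤ p.2 ∧ pairValue a p ∈ Set.Icc (-1 : ℝ) 1}
  have hSinf : S.Infinite := by
    have hinj : Function.Injective fun q : ℚ => (q.num, (q.den : ℤ)) := by
      intro q r h
      simp only [Prod.mk.injEq, Nat.cast_inj] at h
      exact Rat.ext h.1 h.2
    refine ((Real.infinite_rat_abs_sub_lt_one_div_den_sq_of_irrational ha).image
      hinj.injOn).mono ?_
    rintro _ ⟨q, hq, rfl⟩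
    have hd : (0 : ℝ) < q.den := by exact_mod_cast q.pos
    refine ⟨Int.natCast_pos.mpr q.pos, abs_le.mp ?_⟩
    have hval : pairValue a (q.num, (q.den : ℤ)) = -((a - q) * (q.den : ℝ) ^ 2) := by
      simp only [pairValue]
      rw [Rat.cast_def]
      push_cast
      field_simp
      ring
    rw [hval, abs_neg, abs_mul, abs_of_pos (pow_pos hd 2)]
    exact ((lt_div_iff₀ (pow_pos hd 2)).mp hq).le
  have := Filter.cofinite_inf_principal_neBot_iff.mpr hSinf
  have hle : Filter.map (pairValue a) (Filter.cofinite ⊓ Filter.principal S) ≤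
      Filter.principal (Set.Icc (-1 : ℝ) 1) := by
    rw [Filter.le_principal_iff, Filter.mem_map]
    exact Filter.mem_inf_of_right fun p hp => hp.2
  obtain ⟨y, -, hy⟩ := isCompact_Icc.exists_clusterPt hle
  refine ⟨y, mem_Fset_iff.mpr fun δ hδ => ?_⟩
  have hfreq := (mapClusterPt_iff_frequently.mp hy) _ (Metric.ball_mem_nhds y hδ)
  rw [Filter.frequently_inf_principal, Filter.frequently_cofinite_iff_infinite] at hfreq
  refine hfreq.mono fun p hp => ⟨hp.1.1, ?_⟩
  rw [abs_sub_comm]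
  exact hp.2

/-- If the form takes arbitrarily small values of the sign of `s`, then its values of that sign
are dense in the corresponding half-line. -/
theorem exists_mul_pairValue_mem_Ioo {a s : ℝ}
    (h : ∀ δ > 0, ∃ p : ℤ × ℤ, 1 ≤ p.2 ∧ 0 < s * pairValue a p ∧ s * pairValue a p < δ)
    {u w : ℝ} (hu : 0 ≤ u) (huw : u < w) :
    ∃ p : ℤ × ℤ, 1 ≤ p.2 ∧ s * pairValue a p ∈ Set.Ioo u w := by
  have hsq : √u < √w := Real.sqrt_lt_sqrt hu huw
  obtain ⟨p, hp, hpos, hlt⟩ := h ((√w - √u) ^ 2) (pow_pos (sub_pos.mpr hsq) 2)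
  set x := s * pairValue a p with hx
  have hx0 : 0 < √x := Real.sqrt_pos.mpr hpos
  have hxlt : √x < √w - √u := (Real.sqrt_lt' (sub_pos.mpr hsq)).mpr hlt
  set k : ℤ := ⌊√u / √x⌋ + 1 with hk
  have hk1 : 1 ≤ k := by
    have : 0 ≤ ⌊√u / √x⌋ := Int.floor_nonneg.mpr (by positivity)
    omega
  have hlow : √u < k * √x := by
    rw [← div_lt_iff₀ hx0, hk]
    push_cast
    exact Int.lt_floor_add_one _
  have hupp : k * √x < √w := by
    have h1 : (⌊√u / √x⌋ : ℝ) * √x ≤ √u := (le_div_iff₀ hx0).mp (Int.floor_le _)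
    rw [hk]
    push_cast
    linarith
  have hval : s * pairValue a (k * p.1, k * p.2) = (k * √x) ^ 2 := by
    rw [pairValue_smul, mul_pow, Real.sq_sqrt hpos.le, hx]
    ring
  refine ⟨(k * p.1, k * p.2), by nlinarith, ?_, ?_⟩
  · rw [hval]
    exact (Real.sqrt_lt' ((Real.sqrt_nonneg u).trans_lt hlow)).mp hlow
  · rw [hval]
    exact (Real.lt_sqrt ((Real.sqrt_nonneg u).trans hlow.le)).mp hupp

theorem mul_mem_Fset_of_small_values {a s : ℝ} (hs : s * s = 1)
    (h : ∀ δ > 0, ∃ p : ℤ × ℤ, 1 ≤ p.2 ∧ 0 < s * pairValue a p ∧ s * pairValue a p < δ)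
    {y : ℝ} (hy : 0 ≤ y) : s * y ∈ Fset a := by
  rw [mem_Fset_iff]
  intro δ hδ hfin
  set T : Set (ℤ × ℤ) := {p | 1 ≤ p.2 ∧ s * pairValue a p ∈ Set.Ioo y (y + δ)}
  have hTfin : T.Finite := by
    refine hfin.subset fun p hp => ⟨hp.1, ?_⟩
    have hs1 : |s| = 1 := by
      rcases mul_self_eq_one_iff.mp hs with rfl | rfl <;> simp
    have heq : s * y - pairValue a p = s * (y - s * pairValue a p) := by
      linear_combination pairValue a p * hs
    rw [heq, abs_mul, hs1, one_mul, abs_lt]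
    constructor <;> linarith [hp.2.1, hp.2.2]
  obtain ⟨p, hp, hpy⟩ := exists_mul_pairValue_mem_Ioo h hy (lt_add_of_pos_right y hδ)
  obtain ⟨m, hm, hmin⟩ :=
    Set.exists_min_image T (fun p => s * pairValue a p) hTfin ⟨p, hp, hpy⟩
  obtain ⟨r, hr, hry⟩ := exists_mul_pairValue_mem_Ioo h hy hm.2.1
  exact (hmin r ⟨hr, hry.1, hry.2.trans hm.2.2⟩).not_gt hry.2

theorem Fset_infinite_of_small_values {a s : ℝ} (hs : s * s = 1)
    (h : ∀ δ > 0, ∃ p : ℤ × ℤ, 1 ≤ p.2 ∧ 0 < s * pairValue a p ∧ s * pairValue a p < δ) :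
    (Fset a).Infinite := by
  have hs0 : s ≠ 0 := left_ne_zero_of_mul_eq_one hs
  exact Set.infinite_of_injective_forall_mem (f := fun n : ℕ => s * (n : ℝ))
    (fun m n hmn => Nat.cast_injective (mul_left_cancel₀ hs0 hmn))
    fun n => mul_mem_Fset_of_small_values hs h n.cast_nonneg

/-- If `a` is irrational then `𝓕(a)` is infinite. -/
theorem Fset_infinite_of_irrational (a : ℝ) (ha : Irrational a) :
    (Fset a).Infinite := by
  obtain ⟨y, hy⟩ := exists_mem_Fset ha
  rcases ne_or_eq y 0 with hy0 | rfl
  · exact Fset_infinite_of_mem_ne_zero hy hy0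
  by_cases hpos : ∀ δ > 0, ∃ p : ℤ × ℤ, 1 ≤ p.2 ∧ 0 < 1 * pairValue a p ∧ 1 * pairValue a p < δ
  · exact Fset_infinite_of_small_values (by norm_num) hpos
  refine Fset_infinite_of_small_values (s := -1) (by norm_num) fun δ hδ => ?_
  push Not at hpos
  obtain ⟨ε, hε, hnone⟩ := hpos
  obtain ⟨p, hp, hpv⟩ := (mem_Fset_iff.mp hy (min δ ε) (lt_min hδ hε)).nonempty
  rw [zero_sub, abs_neg, lt_min_iff, abs_lt, abs_lt] at hpv
  have hneg : pairValue a p < 0 := by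
    refine (pairValue_ne_zero ha hp).lt_of_le (not_lt.mp fun hlt => ?_)
    linarith [hnone p hp (by linarith), hpv.2.2]
  exact ⟨p, hp, by linarith, by linarith [hpv.1.1]⟩
end

section
/- The sets 𝓕(a) are invariant under the action of the modular group: let a, b ∈ ℝ and n₁, n₂, n₃, n₄ ∈ ℤ with n₁·n₄ − n₂·n₃ = 1, n₃·b + n₄ ≠ 0, and a = (n₁·b + n₂)/(n₃·b + n₄). If y ∈ 𝓕(a) then y ∈ 𝓕(b). -/
/-- Only finitely many of the approximating pairs have bounded `M`, so having infinitely many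
pairs means having pairs with arbitrarily large `M`. -/
theorem mem_Fset_iff_exists_large {a y : ℝ} :
    y ∈ Fset a ↔ ∀ δ > 0, ∀ K : ℝ, ∃ N M : ℤ, 1 ≤ M ∧ K < M ∧
      |y - (M : ℝ) * ((N : ℝ) - (M : ℝ) * a)| < δ := by
  constructor
  · intro hy δ hδ K
    by_contra! hK
    refine hy δ hδ (Set.Finite.subset
      ((Set.finite_Icc (-⌈|y| + δ + |K| * |a|⌉) ⌈|y| + δ + |K| * |a|⌉).prod
        (Set.finite_Icc 1 ⌊K⌋)) ?_)
    rintro ⟨N, M⟩ ⟨hM, hlt⟩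
    simp only at hM hlt
    have hMK : (M : ℝ) ≤ K := by
      by_contra! h
      exact absurd hlt (not_lt.mpr (hK N M hM h))
    have hM1 : (1 : ℝ) ≤ M := by exact_mod_cast hM
    have hv : |(N : ℝ) - M * a| ≤ |y| + δ := by
      have h1 : |(M : ℝ) * (N - M * a)| ≤ |y| + δ := by
        rw [abs_lt] at hlt
        rw [abs_le]
        constructor <;> linarith [neg_abs_le y, le_abs_self y]
      rw [abs_mul, abs_of_pos (by linarith)] at h1
      nlinarith [abs_nonneg ((N : ℝ) - M * a)]
    have hMa : |(M : ℝ) * a| ≤ |K| * |a| := by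
      rw [abs_mul]
      gcongr
    have hN : |(N : ℝ)| ≤ |y| + δ + |K| * |a| := by
      have := abs_add_le ((N : ℝ) - M * a) (M * a)
      rw [sub_add_cancel] at this
      linarith
    have hN' : |N| ≤ ⌈|y| + δ + |K| * |a|⌉ := by
      have := hN.trans (Int.le_ceil _)
      exact_mod_cast this
    exact ⟨abs_le.mp hN', hM, Int.le_floor.mpr hMK⟩
  · intro h δ hδ hfin
    obtain ⟨B, hB⟩ := (hfin.image Prod.snd).bddAbove
    obtain ⟨N, M, hM, hBM, hlt⟩ := h δ hδ B
    have hMB : M ≤ B := hB ⟨(N, M), ⟨hM, hlt⟩, rfl⟩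
    have : B < M := by exact_mod_cast hBM
    omega

/-- Since `(N, M)` and `(-N, -M)` give the same value, pairs with `|M|` large suffice. -/
theorem mem_Fset_of_exists_abs_large {a y : ℝ}
    (h : ∀ δ > 0, ∀ K ≥ 0, ∃ N M : ℤ, K < |(M : ℝ)| ∧
      |y - (M : ℝ) * ((N : ℝ) - (M : ℝ) * a)| < δ) : y ∈ Fset a := by
  refine mem_Fset_iff_exists_large.mpr fun δ hδ K => ?_
  obtain ⟨N, M, hM, hlt⟩ := h δ hδ |K| (abs_nonneg K)
  have hK := le_abs_self K
  have hK0 := abs_nonneg K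
  rcases abs_cases (M : ℝ) with ⟨hMabs, -⟩ | ⟨hMabs, -⟩
  · have hpos : (0 : ℝ) < M := by linarith
    exact ⟨N, M, by exact_mod_cast hpos, by linarith, hlt⟩
  · have hneg : (M : ℝ) < 0 := by linarith
    have hneg' : M < 0 := by exact_mod_cast hneg
    refine ⟨-N, -M, by omega, by push_cast; linarith, ?_⟩
    push_cast
    convert hlt using 2
    ring

/-- The sets `𝓕(a)` are invariant under the action of the modular group. -/
theorem Fset_modular_invariant (a b y : ℝ) (n₁ n₂ n₃ n₄ : ℤ)
    (hdet : n₁ * n₄ - n₂ * n₃ = 1)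
    (hden : (n₃ : ℝ) * b + (n₄ : ℝ) ≠ 0)
    (ha : a = ((n₁ : ℝ) * b + (n₂ : ℝ)) / ((n₃ : ℝ) * b + (n₄ : ℝ)))
    (hy : y ∈ Fset a) : y ∈ Fset b := by
  refine mem_Fset_of_exists_abs_large fun δ hδ K hK => ?_
  have hdet' : (n₁ : ℝ) * n₄ - n₂ * n₃ = 1 := by exact_mod_cast hdet
  set c : ℝ := n₃ * b + n₄ with hc
  have hac : a * c = n₁ * b + n₂ := by rw [ha]; field_simp
  have hcpos : 0 < |c| := abs_pos.mpr hden
  set B : ℝ := |y| + δ with hB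
  have hBpos : 0 < B := by positivity
  obtain ⟨N, M, hM, hlarge, hlt⟩ := mem_Fset_iff_exists_large.mp hy (δ / 2) (half_pos hδ)
    (max (|n₃ * c| * B ^ 2 / (δ / 2)) (|c| * (K + |(n₃ : ℝ)| * B)))
  obtain ⟨hL₁, hL₂⟩ := max_lt_iff.mp hlarge
  have hM1 : (1 : ℝ) ≤ M := by exact_mod_cast hM
  set v : ℝ := N - M * a with hv
  have hMv : M * |v| ≤ B := by
    have h1 : |(M : ℝ) * v| ≤ B := by
      rw [abs_lt] at hlt
      rw [abs_le]
      constructor <;> linarith [neg_abs_le y, le_abs_self y]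
    rwa [abs_mul, abs_of_pos (by linarith)] at h1
  have hvB : |v| ≤ B := by nlinarith [abs_nonneg v]
  -- the new pair is the image of `(N, M)` under the inverse matrix
  have hval : ((n₄ * N - n₂ * M : ℤ) : ℝ) - ((n₁ * M - n₃ * N : ℤ) : ℝ) * b = c * v := by
    push_cast
    linear_combination (N : ℝ) * (-hc) + (M : ℝ) * hac - c * hv
  have hden' : c * ((n₁ * M - n₃ * N : ℤ) : ℝ) = M - c * n₃ * v := by
    push_cast
    have h1 : c * n₁ - n₃ * (a * c) = 1 := by
      rw [hac, hc]
      linear_combination hdet'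
    linear_combination (M : ℝ) * h1 + c * n₃ * hv
  refine ⟨n₄ * N - n₂ * M, n₁ * M - n₃ * N, ?_, ?_⟩
  · have h1 : (M : ℝ) - |c| * (|(n₃ : ℝ)| * B) ≤ |c| * |((n₁ * M - n₃ * N : ℤ) : ℝ)| := by
      rw [← abs_mul, hden']
      have h2 : |c * n₃ * v| ≤ |c| * (|(n₃ : ℝ)| * B) := by
        rw [abs_mul, abs_mul, mul_assoc]
        gcongr
      linarith [le_abs_self (M - c * n₃ * v), le_abs_self (c * n₃ * v)]
    refine lt_of_mul_lt_mul_left ?_ hcpos.le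
    linarith
  · rw [hval]
    have hsq : |n₃ * c * v ^ 2| < δ / 2 := by
      rw [div_lt_iff₀ (half_pos hδ)] at hL₁
      have h1 : M * |v| ^ 2 ≤ B ^ 2 := by nlinarith [abs_nonneg v]
      have h2 : M * |n₃ * c * v ^ 2| ≤ |n₃ * c| * B ^ 2 := by
        rw [abs_mul, abs_pow]
        nlinarith [mul_le_mul_of_nonneg_left h1 (abs_nonneg (n₃ * c))]
      exact lt_of_mul_lt_mul_left (h2.trans_lt hL₁) (by linarith)
    have heq : y - ((n₁ * M - n₃ * N : ℤ) : ℝ) * (c * v) = (y - M * v) + n₃ * c * v ^ 2 := by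
      linear_combination -v * hden'
    rw [heq]
    linarith [abs_add_le (y - M * v) (n₃ * c * v ^ 2)]
end

section
/- Let E₀ ∈ ℝ, and let M : ℝ → Matrix (Fin 2) (Fin 2) ℝ, v : ℝ → (Fin 2 → ℝ), λ : ℝ → ℝ be such that for every E: M(E) is symplectic, M(E)·v(E) = λ(E)·v(E), and ‖v(E)‖ = 1. Assume M, v, λ have derivatives M', v', λ' at E₀, and λ(E₀)² ≠ 1. Then ⟨v'(E₀), J·v(E₀)⟩ = λ(E₀)·⟨v(E₀), J·(M'(E₀)·v(E₀))⟩ / (1 − λ(E₀)²). -/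
open Matrix

attribute [local instance] Matrix.normedAddCommGroup Matrix.normedSpace

/-- The standard skew-symmetric matrix `J`. -/
def Jmat : Matrix (Fin 2) (Fin 2) ℝ := !![0, 1; -1, 0]

theorem dotProduct_Jmat_mulVec (x y : Fin 2 → ℝ) :
    x ⬝ᵥ Jmat.mulVec y = x 0 * y 1 - x 1 * y 0 := by
  simp [Jmat, Matrix.mulVec, dotProduct, Fin.sum_univ_two]
  ring

/-- A symplectic matrix preserves the symplectic form. -/
theorem dotProduct_Jmat_mulVec_of_symplectic {A : Matrix (Fin 2) (Fin 2) ℝ}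
    (hA : Aᵀ * Jmat * A = Jmat) (x y : Fin 2 → ℝ) :
    A.mulVec x ⬝ᵥ Jmat.mulVec (A.mulVec y) = x ⬝ᵥ Jmat.mulVec y := by
  rw [← Matrix.vecMul_transpose, ← Matrix.dotProduct_mulVec, Matrix.mulVec_mulVec,
    Matrix.mulVec_mulVec, hA]

theorem hasDerivAt_mulVec {M : ℝ → Matrix (Fin 2) (Fin 2) ℝ} {v : ℝ → Fin 2 → ℝ}
    {M' : Matrix (Fin 2) (Fin 2) ℝ} {v' : Fin 2 → ℝ} {t : ℝ}
    (hM : HasDerivAt M M' t) (hv : HasDerivAt v v' t) :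
    HasDerivAt (fun s => (M s).mulVec (v s)) (M'.mulVec (v t) + (M t).mulVec v') t := by
  have hM_entry (i j : Fin 2) : HasDerivAt (fun s => M s i j) (M' i j) t :=
    hasDerivAt_pi.1 (hasDerivAt_pi.1 hM i) j
  rw [hasDerivAt_pi]
  intro i
  simp only [Matrix.mulVec, dotProduct, Pi.add_apply, ← Finset.sum_add_distrib]
  exact HasDerivAt.fun_sum fun j _ => (hM_entry i j).mul (hasDerivAt_pi.1 hv j)

/-- Hellmann–Feynman type lemma for real symplectic matrices: if `M E` is symplectic with
eigenvector `v E` of unit (Euclidean) norm and eigenvalue `lam E`, all differentiable at `E₀`,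
and `lam E₀ ^ 2 ≠ 1`, then
`⟨v'(E₀), J·v(E₀)⟩ = lam E₀ * ⟨v(E₀), J·(M'(E₀)·v(E₀))⟩ / (1 - lam E₀ ^ 2)`. -/
theorem hellmann_feynman_symplectic (E₀ : ℝ)
    (M : ℝ → Matrix (Fin 2) (Fin 2) ℝ) (v : ℝ → Fin 2 → ℝ) (lam : ℝ → ℝ)
    (M' : Matrix (Fin 2) (Fin 2) ℝ) (v' : Fin 2 → ℝ) (lam' : ℝ)
    (hsymp : ∀ E, (M E)ᵀ * Jmat * M E = Jmat)
    (heig : ∀ E, (M E).mulVec (v E) = lam E • v E)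
    (hnorm : ∀ E, v E ⬝ᵥ v E = 1)
    (hM : HasDerivAt M M' E₀)
    (hv : HasDerivAt v v' E₀)
    (hlam : HasDerivAt lam lam' E₀)
    (hlam2 : lam E₀ ^ 2 ≠ 1) :
    v' ⬝ᵥ Jmat.mulVec (v E₀) =
      lam E₀ * (v E₀ ⬝ᵥ Jmat.mulVec (M'.mulVec (v E₀))) / (1 - lam E₀ ^ 2) := by
  have hderiv : M'.mulVec (v E₀) + (M E₀).mulVec v' = lam E₀ • v' + lam' • v E₀ := by
    have h := hasDerivAt_mulVec hM hv
    simp only [heig] at h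
    exact h.unique (hlam.smul hv)
  have hform := dotProduct_Jmat_mulVec_of_symplectic (hsymp E₀) (v E₀) v'
  rw [heig] at hform
  have h0 := congrFun hderiv 0
  have h1 := congrFun hderiv 1
  have hne : 1 - lam E₀ ^ 2 ≠ 0 := sub_ne_zero.2 hlam2.symm
  rw [eq_div_iff hne]
  simp only [dotProduct_Jmat_mulVec, Pi.add_apply, Pi.smul_apply, smul_eq_mul] at *
  linear_combination lam E₀ * v E₀ 1 * h0 - lam E₀ * v E₀ 0 * h1 + hform
end

section
/- Let E₀ ∈ ℝ, and let M : ℝ → Matrix (Fin 2) (Fin 2) ℝ, v : ℝ → (Fin 2 → ℝ), λ : ℝ → ℝ be such that for every E: M(E) is symplectic, M(E)·v(E) = λ(E)·v(E), and ‖v(E)‖ = 1; assume M, v, λ have derivatives M', v', λ' at E₀ and λ(E₀)² ≠ 1. (i) If M'(E₀) = M(E₀) * J * Θ for some symmetric positive-definite Θ ∈ Matrix (Fin 2) (Fin 2) ℝ, then ⟨v'(E₀), J·v(E₀)⟩ = ⟨v(E₀), Θ·v(E₀)⟩ / (λ(E₀)² − 1); in particular this quantity is positive if λ(E₀)² > 1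 and negative if λ(E₀)² < 1. (ii) If instead M'(E₀) = J * H * M(E₀) for some symmetric positive-definite H, then ⟨v'(E₀), J·v(E₀)⟩ = λ(E₀)²·⟨v(E₀), H·v(E₀)⟩ / (λ(E₀)² − 1), with the same sign conclusions. -/
open Matrix

attribute [local instance] Matrix.normedAddCommGroup Matrix.normedSpace

theorem hasDerivAt_mulVec_s13 {m n : Type*} [Fintype m] [Fintype n] {x : ℝ}
    {A : ℝ → Matrix m n ℝ} {A' : Matrix m n ℝ} {u : ℝ → n → ℝ} {u' : n → ℝ}
    (hA : HasDerivAt A A' x) (hu : HasDerivAt u u' x) :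
    HasDerivAt (fun t => A t *ᵥ u t) (A' *ᵥ u x + A x *ᵥ u') x := by
  rw [hasDerivAt_pi] at hu ⊢
  intro i
  have hAi := hasDerivAt_pi.1 (hasDerivAt_pi.1 hA i)
  simpa [mulVec, dotProduct, Finset.sum_add_distrib] using
    HasDerivAt.fun_sum fun j (_ : j ∈ Finset.univ) => (hAi j).mul (hu j)

theorem Jmat_mulVec_dotProduct_self (x : Fin 2 → ℝ) : Jmat *ᵥ x ⬝ᵥ x = 0 := by
  simp [Jmat, mulVec, dotProduct, Fin.sum_univ_two]
  ring

theorem Jmat_mulVec_dotProduct_Jmat_mulVec (x y : Fin 2 → ℝ) :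
    Jmat *ᵥ x ⬝ᵥ Jmat *ᵥ y = x ⬝ᵥ y := by
  simp [Jmat, mulVec, dotProduct, Fin.sum_univ_two]
  ring

theorem symplectic_form_mulVec {A : Matrix (Fin 2) (Fin 2) ℝ} (hA : Aᵀ * Jmat * A = Jmat)
    (x y : Fin 2 → ℝ) : Jmat *ᵥ (A *ᵥ x) ⬝ᵥ A *ᵥ y = Jmat *ᵥ x ⬝ᵥ y := by
  rw [dotProduct_mulVec, ← mulVec_transpose, mulVec_mulVec, mulVec_mulVec, hA]

/-- At an eigenvector of a symplectic matrix, the symplectic form absorbs the matrix. -/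
theorem symplectic_form_eigenvector {A : Matrix (Fin 2) (Fin 2) ℝ}
    (hA : Aᵀ * Jmat * A = Jmat) {x : Fin 2 → ℝ} {μ : ℝ} (hx : A *ᵥ x = μ • x)
    (y : Fin 2 → ℝ) : μ * (Jmat *ᵥ x ⬝ᵥ A *ᵥ y) = Jmat *ᵥ x ⬝ᵥ y := by
  rw [← symplectic_form_mulVec hA x y, hx, mulVec_smul, smul_dotProduct, smul_eq_mul]

theorem symplectic_eigenvalue_ne_zero {A : Matrix (Fin 2) (Fin 2) ℝ}
    (hA : Aᵀ * Jmat * A = Jmat) {x : Fin 2 → ℝ} {μ : ℝ} (hx : A *ᵥ x = μ • x)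
    (hx0 : x ⬝ᵥ x ≠ 0) : μ ≠ 0 := by
  rintro rfl
  apply hx0
  rw [← Jmat_mulVec_dotProduct_Jmat_mulVec, ← symplectic_form_eigenvector hA hx, zero_mul]

/-- The rotation rate of an eigenvector of a differentiable family of symplectic matrices. -/
theorem eigenvector_rotation_rate {x : ℝ} {A : ℝ → Matrix (Fin 2) (Fin 2) ℝ}
    {u : ℝ → Fin 2 → ℝ} {μ : ℝ → ℝ} {A' : Matrix (Fin 2) (Fin 2) ℝ} {u' : Fin 2 → ℝ} {μ' : ℝ}
    (hsymp : (A x)ᵀ * Jmat * A x = Jmat) (heig : ∀ t, A t *ᵥ u t = μ t • u t)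
    (hA : HasDerivAt A A' x) (hu : HasDerivAt u u' x) (hμ : HasDerivAt μ μ' x) :
    (u' ⬝ᵥ Jmat *ᵥ u x) * (μ x ^ 2 - 1) = μ x * (Jmat *ᵥ u x ⬝ᵥ A' *ᵥ u x) := by
  have hderiv : A' *ᵥ u x + A x *ᵥ u' = μ x • u' + μ' • u x :=
    (hasDerivAt_mulVec_s13 hA hu).unique ((funext heig : (fun t => A t *ᵥ u t) = _) ▸ hμ.smul hu)
  have hpair := congrArg (fun w => Jmat *ᵥ u x ⬝ᵥ w) hderiv
  simp only [dotProduct_add, dotProduct_smul, Jmat_mulVec_dotProduct_self, smul_eq_mul,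
    mul_zero, add_zero] at hpair
  have habs := symplectic_form_eigenvector hsymp (heig x) u'
  rw [dotProduct_comm u']
  linear_combination (-μ x) * hpair + habs

theorem sign_of_eq_div {r q d : ℝ} (hr : r = q / (d - 1)) (hq : 0 < q) :
    (1 < d → 0 < r) ∧ (d < 1 → r < 0) := by
  subst hr
  exact ⟨fun h => div_pos hq (sub_pos.2 h), fun h => div_neg_of_pos_of_neg hq (sub_neg.2 h)⟩

/-- Signs of the rotation rates of eigenvectors of symplectic matrices: with `M E` symplectic,
`M E · v E = lam E • v E`, `‖v E‖ = 1`, everything differentiable at `E₀`, and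
`lam E₀ ^ 2 ≠ 1`:
(i) if `M'(E₀) = M(E₀) * J * Θ` for a symmetric positive definite `Θ`, then
`⟨v'(E₀), J v(E₀)⟩ = ⟨v(E₀), Θ v(E₀)⟩ / (lam E₀² - 1)`, which is positive when `lam E₀² > 1`
and negative when `lam E₀² < 1`;
(ii) if `M'(E₀) = J * H * M(E₀)` for a symmetric positive definite `H`, then
`⟨v'(E₀), J v(E₀)⟩ = lam E₀² ⟨v(E₀), H v(E₀)⟩ / (lam E₀² - 1)`, with the same signs. -/
theorem eigenvector_rotation_sign (E₀ : ℝ)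
    (M : ℝ → Matrix (Fin 2) (Fin 2) ℝ) (v : ℝ → Fin 2 → ℝ) (lam : ℝ → ℝ)
    (M' : Matrix (Fin 2) (Fin 2) ℝ) (v' : Fin 2 → ℝ) (lam' : ℝ)
    (hsymp : ∀ E, (M E)ᵀ * Jmat * M E = Jmat)
    (heig : ∀ E, (M E).mulVec (v E) = lam E • v E)
    (hnorm : ∀ E, v E ⬝ᵥ v E = 1)
    (hM : HasDerivAt M M' E₀)
    (hv : HasDerivAt v v' E₀)
    (hlam : HasDerivAt lam lam' E₀)
    (hlam2 : lam E₀ ^ 2 ≠ 1) :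
    (∀ Θ : Matrix (Fin 2) (Fin 2) ℝ, Θ.IsSymm → Θ.PosDef →
      M' = M E₀ * Jmat * Θ →
      (v' ⬝ᵥ Jmat.mulVec (v E₀) = (v E₀ ⬝ᵥ Θ.mulVec (v E₀)) / (lam E₀ ^ 2 - 1) ∧
        (1 < lam E₀ ^ 2 → 0 < v' ⬝ᵥ Jmat.mulVec (v E₀)) ∧
        (lam E₀ ^ 2 < 1 → v' ⬝ᵥ Jmat.mulVec (v E₀) < 0))) ∧
    (∀ H : Matrix (Fin 2) (Fin 2) ℝ, H.IsSymm → H.PosDef →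
      M' = Jmat * H * M E₀ →
      (v' ⬝ᵥ Jmat.mulVec (v E₀) =
          lam E₀ ^ 2 * (v E₀ ⬝ᵥ H.mulVec (v E₀)) / (lam E₀ ^ 2 - 1) ∧
        (1 < lam E₀ ^ 2 → 0 < v' ⬝ᵥ Jmat.mulVec (v E₀)) ∧
        (lam E₀ ^ 2 < 1 → v' ⬝ᵥ Jmat.mulVec (v E₀) < 0))) := by
  have hrate := eigenvector_rotation_rate (hsymp E₀) heig hM hv hlam
  have hd : lam E₀ ^ 2 - 1 ≠ 0 := sub_ne_zero.2 hlam2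
  have hv1 : v E₀ ⬝ᵥ v E₀ ≠ 0 := by simp [hnorm]
  have hv0 : v E₀ ≠ 0 := fun h => hv1 (by simp [h])
  have hlam0 := symplectic_eigenvalue_ne_zero (hsymp E₀) (heig E₀) hv1
  have hpos : ∀ P : Matrix (Fin 2) (Fin 2) ℝ, P.PosDef → 0 < v E₀ ⬝ᵥ P *ᵥ v E₀ :=
    fun P hP => by simpa using hP.dotProduct_mulVec_pos hv0
  constructor
  · rintro Θ - hΘ rfl
    rw [← mulVec_mulVec, ← mulVec_mulVec, symplectic_form_eigenvector (hsymp E₀) (heig E₀),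
      Jmat_mulVec_dotProduct_Jmat_mulVec] at hrate
    have hformula := (eq_div_iff hd).2 hrate
    exact ⟨hformula, sign_of_eq_div hformula (hpos Θ hΘ)⟩
  · rintro H - hH rfl
    rw [← mulVec_mulVec, ← mulVec_mulVec, Jmat_mulVec_dotProduct_Jmat_mulVec, heig,
      mulVec_smul, dotProduct_smul, smul_eq_mul, ← mul_assoc, ← sq] at hrate
    have hformula := (eq_div_iff hd).2 hrate
    exact ⟨hformula, sign_of_eq_div hformula (mul_pos (by positivity) (hpos H hH))⟩
end

section
/- Let E ∈ ℝ and let q : ℝ → ℝ be bounded and piecewise continuous (continuous off a locally finite set). Let U : ℝ → Matrix (Fin 2) (Fin 2) ℝ be continuous with U(x) = 1 + ∫₀ˣ !![0, 1; q(s) − E, 0] * U(s) ds for all x ∈ ℝ. Then for every x > 0 the symmetric matrix Θ(x) = ∫₀ˣ (U(y))ᵀ * !![1, 0; 0, 0] * U(y) dy is positive definite. -/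
open Matrix MeasureTheory

/-- A set `S ⊆ ℝ` is locally finite if every point has a neighborhood meeting `S`
in a finite set. -/
def LocallyFiniteSet (S : Set ℝ) : Prop :=
  ∀ x : ℝ, ∃ U ∈ nhds x, (S ∩ U).Finite

/-- A function is piecewise continuous if it is continuous off a locally finite set. -/
def PiecewiseContinuous (f : ℝ → ℝ) : Prop :=
  ∃ S : Set ℝ, LocallyFiniteSet S ∧ ContinuousOn f Sᶜ

/-- If `a y = c + ∫₀ʸ b` with `b` continuous and `a` vanishes on `[0, x]`, then `c = b 0 = 0`. -/
lemma eq_zero_of_integral_eq_zero {a b : ℝ → ℝ} {c x : ℝ} (hb : Continuous b)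
    (hab : ∀ y, a y = c + ∫ s in (0:ℝ)..y, b s) (hx : 0 < x)
    (ha : ∀ y ∈ Set.Icc 0 x, a y = 0) : c = 0 ∧ b 0 = 0 := by
  have hmem : (0:ℝ) ∈ Set.Icc 0 x := ⟨le_rfl, hx.le⟩
  refine ⟨by simpa [hab 0] using ha 0 hmem, ?_⟩
  have hderiv : HasDerivAt a (b 0) 0 := by
    rw [funext hab]
    exact (intervalIntegral.integral_hasDerivAt_right (hb.intervalIntegrable _ _)
      (hb.stronglyMeasurableAtFilter _ _) hb.continuousAt).const_add c
  have hzero : HasDerivWithinAt a 0 (Set.Icc 0 x) 0 :=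
    (hasDerivWithinAt_const (0:ℝ) _ (0:ℝ)).congr_of_mem ha hmem
  exact (uniqueDiffOn_Icc hx 0 hmem).eq_deriv _ hderiv.hasDerivWithinAt hzero

/-- If `U` is the (continuous) fundamental solution matrix of `-u'' + q u = E u`, i.e.
`U x = 1 + ∫₀ˣ !![0, 1; q s - E, 0] * U s ds`, with `q` bounded and piecewise continuous,
then for every `x > 0` the symmetric matrix `Θ x = ∫₀ˣ (U y)ᵀ * !![1, 0; 0, 0] * U y dy`
is positive definite. -/
theorem theta_posDef (E : ℝ) (q : ℝ → ℝ)
    (hqb : ∃ C, ∀ x, |q x| ≤ C) (hqc : PiecewiseContinuous q)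
    (U : ℝ → Matrix (Fin 2) (Fin 2) ℝ)
    (hUc : ∀ i j, Continuous fun x => U x i j)
    (hU : ∀ (x : ℝ) (i j : Fin 2), U x i j =
      (1 : Matrix (Fin 2) (Fin 2) ℝ) i j +
        ∫ s in (0:ℝ)..x, (!![0, 1; q s - E, 0] * U s) i j)
    (x : ℝ) (hx : 0 < x) :
    (Matrix.of fun i j =>
      ∫ y in (0:ℝ)..x, ((U y)ᵀ * !![(1:ℝ), 0; 0, 0] * U y) i j).PosDef := by
  have hone : ∀ i j, U 0 i j = (1 : Matrix (Fin 2) (Fin 2) ℝ) i j := fun i j => by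
    simpa using hU 0 i j
  have hentry : ∀ y i j, ((U y)ᵀ * !![(1:ℝ), 0; 0, 0] * U y) i j = U y 0 i * U y 0 j := by
    intro y i j
    simp [Matrix.mul_apply, Fin.sum_univ_two]
  have hint : ∀ i j, IntervalIntegrable (fun y => U y 0 i * U y 0 j) volume 0 x := fun i j =>
    ((hUc 0 i).mul (hUc 0 j)).intervalIntegrable _ _
  simp only [hentry]
  refine Matrix.PosDef.of_dotProduct_mulVec_pos ?_ fun v hv => ?_
  · ext i j
    simp [mul_comm]
  have hform : star v ⬝ᵥ ((Matrix.of fun i j => ∫ y in (0:ℝ)..x, U y 0 i * U y 0 j) *ᵥ v) =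
      ∫ y in (0:ℝ)..x, (U y 0 0 * v 0 + U y 0 1 * v 1) ^ 2 := by
    have hexpand : ∀ y, (U y 0 0 * v 0 + U y 0 1 * v 1) ^ 2 =
        ∑ i, ∑ j, v i * v j * (U y 0 i * U y 0 j) := fun y => by
      simp only [Fin.sum_univ_two]; ring
    simp only [hexpand]
    have hsum : ∀ i, IntervalIntegrable (fun y => ∑ j, v i * v j * (U y 0 i * U y 0 j))
        volume 0 x := fun i => by
      simpa only [Finset.sum_fn] using
        IntervalIntegrable.sum Finset.univ fun j _ => (hint i j).const_mul (v i * v j)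
    rw [intervalIntegral.integral_finsetSum fun i _ => hsum i]
    simp only [dotProduct, mulVec, Matrix.of_apply, Finset.mul_sum, Pi.star_apply, star_trivial]
    refine Finset.sum_congr rfl fun i _ => ?_
    rw [intervalIntegral.integral_finsetSum fun j _ => (hint i j).const_mul _]
    refine Finset.sum_congr rfl fun j _ => ?_
    rw [intervalIntegral.integral_const_mul]
    ring
  have hcont : ∀ i, Continuous fun y => U y i 0 * v 0 + U y i 1 * v 1 := fun i =>
    ((hUc i 0).mul_const _).add ((hUc i 1).mul_const _)
  rw [hform]
  refine intervalIntegral.integral_pos hx ((hcont 0).pow 2).continuousOn (fun _ _ => sq_nonneg _) ?_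
  by_contra! hneg
  have hvanish : ∀ y ∈ Set.Icc 0 x, U y 0 0 * v 0 + U y 0 1 * v 1 = 0 := fun y hy =>
    pow_eq_zero_iff two_ne_zero |>.mp (le_antisymm (hneg y hy) (sq_nonneg _))
  have hrow : ∀ y, U y 0 0 * v 0 + U y 0 1 * v 1 =
      v 0 + ∫ s in (0:ℝ)..y, (U s 1 0 * v 0 + U s 1 1 * v 1) := fun y => by
    rw [intervalIntegral.integral_add (((hUc 1 0).mul_const _).intervalIntegrable _ _)
      (((hUc 1 1).mul_const _).intervalIntegrable _ _), intervalIntegral.integral_mul_const,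
      intervalIntegral.integral_mul_const, hU y 0 0, hU y 0 1]
    simp [Matrix.mul_apply, Fin.sum_univ_two]
    ring
  obtain ⟨h0, h1⟩ := eq_zero_of_integral_eq_zero (hcont 1) hrow hx hvanish
  refine hv (funext fun i => ?_)
  fin_cases i
  · exact h0
  · simpa [hone] using h1
end

section
/- Let E₀ ∈ ℝ. Let M, N : ℝ → Matrix (Fin 2) (Fin 2) ℝ, v₊, v₋ : ℝ → (Fin 2 → ℝ), and λ₊, λ₋ : ℝ → ℝ satisfy, for every E: M(E) and N(E) are symplectic, M(E)·v₊(E) = λ₊(E)·v₊(E), M(E)·v₋(E) = λ₋(E)·v₋(E), and ‖v₊(E)‖ = ‖v₋(E)‖ = 1. Assume M, N, v₊, v₋, λ₊, λ₋ have derivatives at E₀, that |λ₋(E₀)| < 1 < |λ₊(E₀)|, that M'(E₀) = M(E₀) * J * Φ and N'(E₀) = N(E₀) * J * Θ with Φ, Θ symmetric positive definite, and that N(E₀)·v₊(E₀) = μ·v₋(E₀) for some real μ ≠ 0 (so the Evans function f(E) := ⟨v₋(E), J·(N(E)·v₊(E))⟩ vanishes at E₀). Then f has derivative at E₀ equal to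 μ·α₋ − α₊/μ − (1/μ)·⟨v₊(E₀), Θ·v₊(E₀)⟩, where α₊ = ⟨v₊'(E₀), J·v₊(E₀)⟩ and α₋ = ⟨v₋'(E₀), J·v₋(E₀)⟩; moreover f'(E₀) ≠ 0 and μ·f'(E₀) < 0. -/
open Matrix

attribute [local instance] Matrix.normedAddCommGroup Matrix.normedSpace

theorem HasDerivAt.fin_dotProduct {n : ℕ} {v w : ℝ → Fin n → ℝ} {v' w' : Fin n → ℝ} {x : ℝ}
    (hv : HasDerivAt v v' x) (hw : HasDerivAt w w' x) :
    HasDerivAt (fun t => v t ⬝ᵥ w t) (v' ⬝ᵥ w x + v x ⬝ᵥ w') x := by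
  simp only [dotProduct, ← Finset.sum_add_distrib]
  exact HasDerivAt.fun_sum fun i _ => (hasDerivAt_pi.1 hv i).mul (hasDerivAt_pi.1 hw i)

theorem HasDerivAt.fin_mulVec {m n : ℕ} {A : ℝ → Matrix (Fin m) (Fin n) ℝ}
    {A' : Matrix (Fin m) (Fin n) ℝ} {v : ℝ → Fin n → ℝ} {v' : Fin n → ℝ} {x : ℝ}
    (hA : HasDerivAt A A' x) (hv : HasDerivAt v v' x) :
    HasDerivAt (fun t => A t *ᵥ v t) (A' *ᵥ v x + A x *ᵥ v') x :=
  hasDerivAt_pi.2 fun i => (hasDerivAt_pi.1 hA i).fin_dotProduct hv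

theorem dotProduct_Jmat_swap (x y : Fin 2 → ℝ) : x ⬝ᵥ Jmat *ᵥ y = -(y ⬝ᵥ Jmat *ᵥ x) := by
  simp [Jmat, dotProduct, mulVec, Fin.sum_univ_two]
  ring

theorem dotProduct_Jmat_self (x : Fin 2 → ℝ) : x ⬝ᵥ Jmat *ᵥ x = 0 := by
  linarith [dotProduct_Jmat_swap x x]

theorem Jmat_mulVec_Jmat_mulVec (x : Fin 2 → ℝ) : Jmat *ᵥ (Jmat *ᵥ x) = -x := by
  ext i
  fin_cases i <;> simp [Jmat, mulVec, dotProduct, Fin.sum_univ_two]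

theorem symplectic_dotProduct {A : Matrix (Fin 2) (Fin 2) ℝ} (hA : Aᵀ * Jmat * A = Jmat)
    (x y : Fin 2 → ℝ) : (A *ᵥ x) ⬝ᵥ Jmat *ᵥ (A *ᵥ y) = x ⬝ᵥ Jmat *ᵥ y := by
  conv_rhs => rw [← hA]
  rw [← vecMul_transpose, ← dotProduct_mulVec, mulVec_mulVec, mulVec_mulVec, Matrix.mul_assoc]

/-- For an eigenvector branch `v` of a symplectic family with `M' = M J Φ`, the quadratic form of
`Φ` at `v` is `(λ² - 1) ⟨v', J v⟩`. -/
theorem quadForm_eq_of_symplectic_eigenvector {M : ℝ → Matrix (Fin 2) (Fin 2) ℝ}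
    {v : ℝ → Fin 2 → ℝ} {lam : ℝ → ℝ} {Φ : Matrix (Fin 2) (Fin 2) ℝ}
    {v' : Fin 2 → ℝ} {lam' x : ℝ} (hsymp : (M x)ᵀ * Jmat * M x = Jmat)
    (heig : ∀ t, M t *ᵥ v t = lam t • v t)
    (hM : HasDerivAt M (M x * Jmat * Φ) x) (hv : HasDerivAt v v' x)
    (hlam : HasDerivAt lam lam' x) :
    v x ⬝ᵥ Φ *ᵥ v x = (lam x ^ 2 - 1) * (v' ⬝ᵥ Jmat *ᵥ v x) := by
  have hderiv : (M x * Jmat * Φ) *ᵥ v x + M x *ᵥ v' = lam x • v' + lam' • v x := by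
    refine (hM.fin_mulVec hv).unique ?_
    simp only [heig]
    exact hlam.smul hv
  have hpair := congrArg (fun w => (M x *ᵥ v x) ⬝ᵥ Jmat *ᵥ w) hderiv
  simp only [Matrix.mul_assoc, ← mulVec_mulVec, mulVec_add, dotProduct_add,
    symplectic_dotProduct hsymp, Jmat_mulVec_Jmat_mulVec] at hpair
  simp only [heig, mulVec_smul, dotProduct_smul, smul_dotProduct, smul_eq_mul, dotProduct_neg,
    dotProduct_Jmat_self] at hpair
  rw [dotProduct_Jmat_swap (v x) v'] at hpair
  linear_combination -hpair

/-- Derivative of the Evans function `f E = ⟨v₋ E, J (N E (v₊ E))⟩` at a zero `E₀`: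
it equals `μ α₋ - α₊ / μ - (1/μ) ⟨v₊(E₀), Θ v₊(E₀)⟩`, is nonzero, and has sign opposite
to `μ`. -/
theorem evans_function_deriv (E₀ : ℝ)
    (M N : ℝ → Matrix (Fin 2) (Fin 2) ℝ)
    (vp vm : ℝ → Fin 2 → ℝ) (lamp lamm : ℝ → ℝ)
    (M' N' : Matrix (Fin 2) (Fin 2) ℝ)
    (vp' vm' : Fin 2 → ℝ) (lamp' lamm' : ℝ)
    (Φ Θ : Matrix (Fin 2) (Fin 2) ℝ) (μ : ℝ)
    (hMsymp : ∀ E, (M E)ᵀ * Jmat * M E = Jmat)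
    (hNsymp : ∀ E, (N E)ᵀ * Jmat * N E = Jmat)
    (heigp : ∀ E, (M E).mulVec (vp E) = lamp E • vp E)
    (heigm : ∀ E, (M E).mulVec (vm E) = lamm E • vm E)
    (hnormp : ∀ E, vp E ⬝ᵥ vp E = 1)
    (hnormm : ∀ E, vm E ⬝ᵥ vm E = 1)
    (hM : HasDerivAt M M' E₀) (hN : HasDerivAt N N' E₀)
    (hvp : HasDerivAt vp vp' E₀) (hvm : HasDerivAt vm vm' E₀)
    (hlamp : HasDerivAt lamp lamp' E₀) (hlamm : HasDerivAt lamm lamm' E₀)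
    (hhyp : |lamm E₀| < 1 ∧ 1 < |lamp E₀|)
    (hM' : M' = M E₀ * Jmat * Φ) (hΦs : Φ.IsSymm) (hΦ : Φ.PosDef)
    (hN' : N' = N E₀ * Jmat * Θ) (hΘs : Θ.IsSymm) (hΘ : Θ.PosDef)
    (hμ : μ ≠ 0)
    (hzero : (N E₀).mulVec (vp E₀) = μ • vm E₀) :
    HasDerivAt (fun E => vm E ⬝ᵥ Jmat.mulVec ((N E).mulVec (vp E)))
      (μ * (vm' ⬝ᵥ Jmat.mulVec (vm E₀)) - (vp' ⬝ᵥ Jmat.mulVec (vp E₀)) / μ -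
        (1 / μ) * (vp E₀ ⬝ᵥ Θ.mulVec (vp E₀))) E₀ ∧
    (μ * (vm' ⬝ᵥ Jmat.mulVec (vm E₀)) - (vp' ⬝ᵥ Jmat.mulVec (vp E₀)) / μ -
        (1 / μ) * (vp E₀ ⬝ᵥ Θ.mulVec (vp E₀))) ≠ 0 ∧
    μ * (μ * (vm' ⬝ᵥ Jmat.mulVec (vm E₀)) - (vp' ⬝ᵥ Jmat.mulVec (vp E₀)) / μ -
        (1 / μ) * (vp E₀ ⬝ᵥ Θ.mulVec (vp E₀))) < 0 := by
  subst hM' hN'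
  have hquadp := quadForm_eq_of_symplectic_eigenvector (hMsymp E₀) heigp hM hvp hlamp
  have hquadm := quadForm_eq_of_symplectic_eigenvector (hMsymp E₀) heigm hM hvm hlamm
  have ne_zero_of_norm {v : Fin 2 → ℝ} (h : v ⬝ᵥ v = 1) : v ≠ 0 := by
    rintro rfl
    simp at h
  have hvp0 := ne_zero_of_norm (hnormp E₀)
  have hΦp : 0 < vp E₀ ⬝ᵥ Φ *ᵥ vp E₀ := by simpa using hΦ.dotProduct_mulVec_pos hvp0
  have hΦm : 0 < vm E₀ ⬝ᵥ Φ *ᵥ vm E₀ := by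
    simpa using hΦ.dotProduct_mulVec_pos (ne_zero_of_norm (hnormm E₀))
  have hΘp : 0 < vp E₀ ⬝ᵥ Θ *ᵥ vp E₀ := by simpa using hΘ.dotProduct_mulVec_pos hvp0
  have hlm : lamm E₀ ^ 2 < 1 := (sq_lt_one_iff_abs_lt_one _).2 hhyp.1
  have hlp : 1 < lamp E₀ ^ 2 := (one_lt_sq_iff_one_lt_abs _).2 hhyp.2
  have hαp : 0 < vp' ⬝ᵥ Jmat *ᵥ vp E₀ := by
    rw [hquadp] at hΦp
    exact pos_of_mul_pos_right hΦp (by linarith)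
  have hαm : vm' ⬝ᵥ Jmat *ᵥ vm E₀ < 0 := by
    rw [hquadm] at hΦm
    exact neg_of_mul_pos_right hΦm (by linarith)
  have hsign : μ * (μ * (vm' ⬝ᵥ Jmat.mulVec (vm E₀)) - (vp' ⬝ᵥ Jmat.mulVec (vp E₀)) / μ -
        (1 / μ) * (vp E₀ ⬝ᵥ Θ.mulVec (vp E₀))) < 0 := by
    have hexpand : μ * (μ * (vm' ⬝ᵥ Jmat.mulVec (vm E₀)) -
        (vp' ⬝ᵥ Jmat.mulVec (vp E₀)) / μ - (1 / μ) * (vp E₀ ⬝ᵥ Θ.mulVec (vp E₀))) =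
        μ ^ 2 * (vm' ⬝ᵥ Jmat *ᵥ vm E₀) - vp' ⬝ᵥ Jmat *ᵥ vp E₀ - vp E₀ ⬝ᵥ Θ *ᵥ vp E₀ := by
      field_simp
    rw [hexpand]
    linarith [mul_neg_of_pos_of_neg (sq_pos_of_ne_zero hμ) hαm]
  refine ⟨?_, right_ne_zero_of_mul hsign.ne, hsign⟩
  have hderiv := hvm.fin_dotProduct
    ((hasDerivAt_const E₀ Jmat).fin_mulVec (hN.fin_mulVec hvp))
  refine hderiv.congr_deriv ?_
  have hvm_eq : vm E₀ = μ⁻¹ • N E₀ *ᵥ vp E₀ := by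
    rw [hzero, smul_smul, inv_mul_cancel₀ hμ, one_smul]
  have hpair (w : Fin 2 → ℝ) :
      vm E₀ ⬝ᵥ Jmat *ᵥ (N E₀ *ᵥ w) = μ⁻¹ * (vp E₀ ⬝ᵥ Jmat *ᵥ w) := by
    rw [hvm_eq, smul_dotProduct, symplectic_dotProduct (hNsymp E₀), smul_eq_mul]
  simp only [zero_mulVec, dotProduct_zero, Matrix.mul_assoc, ← mulVec_mulVec, mulVec_add,
    dotProduct_add, hpair, Jmat_mulVec_Jmat_mulVec, hzero, mulVec_smul, dotProduct_smul,
    smul_eq_mul, dotProduct_neg]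
  rw [dotProduct_Jmat_swap (vp E₀) vp']
  ring
end

section
/- Let N, H ∈ Matrix (Fin 2) (Fin 2) ℝ with det N = 1, trace N = 2, and H symmetric positive definite. If trace (J * H * N) = 0, then N = 1 (the identity matrix). -/
open Matrix

/-- If `det N = 1`, `trace N = 2`, `H` is symmetric positive definite, and
`trace (J * H * N) = 0`, then `N` is the identity matrix. -/
theorem eq_one_of_trace_JHN_eq_zero (N H : Matrix (Fin 2) (Fin 2) ℝ)
    (hdet : N.det = 1) (htr : N.trace = 2)
    (hHs : H.IsSymm) (hH : H.PosDef)
    (h : (Jmat * H * N).trace = 0) :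
    N = 1 := by
  have hp : 0 < H 0 0 := hH.diag_pos
  have hr : 0 < H 1 1 := hH.diag_pos
  have hD : 0 < H.det := hH.det_pos
  have hq : H 1 0 = H 0 1 := hHs.apply 0 1
  rw [det_fin_two, hq] at hD
  rw [det_fin_two] at hdet
  rw [trace_fin_two] at htr
  simp only [Jmat, trace_fin_two, mul_apply, Fin.sum_univ_two, of_apply, cons_val', cons_val_zero,
    cons_val_one, cons_val_fin_one, hq] at h
  have hd : N 1 1 = 2 - N 0 0 := by linarith
  rw [hd] at hdet h
  have hlin : H 1 1 * N 1 0 - H 0 0 * N 0 1 = -2 * H 0 1 * (N 0 0 - 1) := by linarith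
  have hbc : N 0 1 * N 1 0 = -(N 0 0 - 1) ^ 2 := by linarith
  have hsq : (H 1 1 * N 1 0 + H 0 0 * N 0 1) ^ 2
      + 4 * ((H 0 0 * H 1 1 - H 0 1 * H 0 1) * (N 0 0 - 1) ^ 2) = 0 := by
    linear_combination (H 1 1 * N 1 0 - H 0 0 * N 0 1 - 2 * H 0 1 * (N 0 0 - 1)) * hlin
      + 4 * H 0 0 * H 1 1 * hbc
  have hDt : (H 0 0 * H 1 1 - H 0 1 * H 0 1) * (N 0 0 - 1) ^ 2 = 0 := by
    have := mul_nonneg hD.le (sq_nonneg (N 0 0 - 1))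
    nlinarith [sq_nonneg (H 1 1 * N 1 0 + H 0 0 * N 0 1)]
  have ht : N 0 0 - 1 = 0 := by simpa [hD.ne'] using hDt
  have hsum : H 1 1 * N 1 0 + H 0 0 * N 0 1 = 0 := by simpa [hDt] using hsq
  rw [ht, mul_zero] at hlin
  have hc : N 1 0 = 0 := by
    have : H 1 1 * N 1 0 = 0 := by linarith
    simpa [hr.ne'] using this
  have hb : N 0 1 = 0 := by
    have : H 0 0 * N 0 1 = 0 := by linarith
    simpa [hp.ne'] using this
  ext i j
  fin_cases i <;> fin_cases j <;> simp [hb, hc] <;> linarith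
end

section
/- Let x₀ ∈ ℝ, let H : ℝ → Matrix (Fin 2) (Fin 2) ℝ take symmetric values, be differentiable at x₀, and have H(x₀) positive definite, and let N : ℝ → Matrix (Fin 2) (Fin 2) ℝ satisfy N'(x) = J * H(x) * N(x) for all x (in the sense of HasDerivAt) and N(x₀) = 1. Then the function x ↦ trace (N(x)) has first derivative 0 at x₀ and has a second derivative at x₀ equal to −2·det (H(x₀)), which is strictly negative; equivalently, its derivative x ↦ trace (J * H(x) * N(x)) vanishes at x₀ and has derivative −2·det (H(x₀)) < 0 at x₀. -/
open Matrix

attribute [local instance] Matrix.normedAddCommGroup Matrix.normedSpace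

/-- Each entry of a differentiable matrix-valued function is differentiable. -/
theorem HasDerivAt.matrix_entry {m n : Type*} [Fintype m] [Fintype n]
    {A : ℝ → Matrix m n ℝ} {A' : Matrix m n ℝ} {x : ℝ}
    (hA : HasDerivAt A A' x) (i : m) (j : n) : HasDerivAt (fun y => A y i j) (A' i j) x :=
  hasDerivAt_pi.mp (hasDerivAt_pi.mp hA i) j

theorem Jmat_mul_mul_trace (A B : Matrix (Fin 2) (Fin 2) ℝ) :
    (Jmat * A * B).trace = A 1 0 * B 0 0 + A 1 1 * B 1 0 - A 0 0 * B 0 1 - A 0 1 * B 1 1 := by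
  simp [Jmat, Matrix.trace_fin_two, Matrix.mul_apply, Fin.sum_univ_two, -Matrix.cons_mul]
  ring

/-- At a point `x₀` where `N x₀ = 1`, for a solution of `N' = J H N` with `H` symmetric,
differentiable at `x₀` and positive definite at `x₀`, the Floquet discriminant
`x ↦ trace (N x)` has vanishing first derivative at `x₀` and second derivative
`-2 det (H x₀) < 0`; equivalently, its derivative `x ↦ trace (J * H x * N x)`
vanishes at `x₀` and has derivative `-2 det (H x₀) < 0` there. -/
theorem discriminant_max_at_double_point (x₀ : ℝ)
    (H : ℝ → Matrix (Fin 2) (Fin 2) ℝ) (H' : Matrix (Fin 2) (Fin 2) ℝ)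
    (hHsymm : ∀ x, (H x).IsSymm)
    (hH' : HasDerivAt H H' x₀)
    (hHpd : (H x₀).PosDef)
    (N : ℝ → Matrix (Fin 2) (Fin 2) ℝ)
    (hN : ∀ x, HasDerivAt N (Jmat * H x * N x) x)
    (hN0 : N x₀ = 1) :
    HasDerivAt (fun x => (N x).trace) 0 x₀ ∧
    (Jmat * H x₀ * N x₀).trace = 0 ∧
    HasDerivAt (fun x => (Jmat * H x * N x).trace) (-2 * (H x₀).det) x₀ ∧
    -2 * (H x₀).det < 0 := by
  have hH10 : H x₀ 1 0 = H x₀ 0 1 := (hHsymm x₀).apply 0 1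
  have hH'10 : H' 1 0 = H' 0 1 := by
    have h := hH'.matrix_entry 1 0
    simp only [fun x => (hHsymm x).apply 0 1] at h
    exact h.unique (hH'.matrix_entry 0 1)
  have htrace : (Jmat * H x₀ * N x₀).trace = 0 := by
    rw [Jmat_mul_mul_trace]
    simp [hN0, hH10]
  refine ⟨?_, htrace, ?_, by linarith [hHpd.det_pos]⟩
  · rw [← htrace]
    simpa only [Matrix.trace_fin_two] using
      ((hN x₀).matrix_entry 0 0).fun_add ((hN x₀).matrix_entry 1 1)
  · simp only [Jmat_mul_mul_trace]
    have hprod (i j k l : Fin 2) := (hH'.matrix_entry i j).fun_mul ((hN x₀).matrix_entry k l)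
    refine ((((hprod 1 0 0 0).fun_add (hprod 1 1 1 0)).fun_sub (hprod 0 0 0 1)).fun_sub
      (hprod 0 1 1 1)).congr_deriv ?_
    simp [Jmat, hN0, Matrix.mul_apply, Fin.sum_univ_two, Matrix.det_fin_two, hH10, hH'10,
      -Matrix.cons_mul]
    ring
end

section
/- Let x_low < x_high be real numbers, let H : ℝ → Matrix (Fin 2) (Fin 2) ℝ be continuous with H(x) symmetric positive definite for every x ∈ [x_low, x_high], and let N : ℝ → Matrix (Fin 2) (Fin 2) ℝ satisfy N'(x) = J * H(x) * N(x) for all x (in the sense of HasDerivAt) with N(x_low) symplectic. Suppose (trace N(x))² > 4 for all x ∈ (x_low, x_high) and (trace N(x_low))² = (trace N(x_high))² = 4. Then for every v : Fin 2 → ℝ with ‖v‖ = 1 there exists exactly one x ∈ [x_low, x_high] such that ⟨v, J·(N(x)·v)⟩ = 0. -/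
open Matrix

attribute [local instance] Matrix.normedAddCommGroup Matrix.normedSpace

/-- The derivative at the left end of an interval is nonnegative if the function is minimal there. -/
lemma HasDerivAt.nonneg_of_le_right {f : ℝ → ℝ} {f' x y : ℝ} (hxy : x < y)
    (hf : HasDerivAt f f' x) (h : ∀ z ∈ Set.Ioo x y, f x ≤ f z) : 0 ≤ f' := by
  have hs := (hasDerivAt_iff_tendsto_slope.1 hf).mono_left
    (nhdsWithin_mono x (fun z (hz : z ∈ Set.Ioi x) => ne_of_gt hz))
  refine ge_of_tendsto hs ?_
  filter_upwards [Ioo_mem_nhdsGT hxy] with z hz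
  rw [slope_def_field]
  exact div_nonneg (sub_nonneg.2 (h z hz)) (sub_nonneg.2 hz.1.le)

/-- The derivative at the right end of an interval is nonnegative if the function is maximal
there. -/
lemma HasDerivAt.nonneg_of_le_left {f : ℝ → ℝ} {f' x y : ℝ} (hxy : x < y)
    (hf : HasDerivAt f f' y) (h : ∀ z ∈ Set.Ioo x y, f z ≤ f y) : 0 ≤ f' := by
  have hs := (hasDerivAt_iff_tendsto_slope.1 hf).mono_left
    (nhdsWithin_mono y (fun z (hz : z ∈ Set.Iio y) => ne_of_lt hz))
  refine ge_of_tendsto hs ?_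
  filter_upwards [Ioo_mem_nhdsLT hxy] with z hz
  rw [slope_def_field]
  exact div_nonneg_of_nonpos (sub_nonpos.2 (h z hz)) (sub_nonpos.2 hz.2.le)

/-- A function whose derivative is negative at each of its zeros has at most one zero. -/
lemma eq_of_zeros_of_deriv_neg {f f' : ℝ → ℝ} {l u : ℝ} (hf : ∀ x, HasDerivAt f (f' x) x)
    (hneg : ∀ x ∈ Set.Icc l u, f x = 0 → f' x < 0) {x y : ℝ} (hx : x ∈ Set.Icc l u)
    (hy : y ∈ Set.Icc l u) (hfx : f x = 0) (hfy : f y = 0) : x = y := by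
  wlog hxy : x ≤ y generalizing x y
  · exact (this hy hx hfy hfx (le_of_not_ge hxy)).symm
  by_contra hne
  have hle : ∀ ⦃z⦄, z ∈ Set.Icc x y → f z ≤ (fun _ => (0 : ℝ)) z :=
    image_le_of_deriv_right_lt_deriv_boundary (B := fun _ => (0 : ℝ)) (B' := fun _ => 0)
      (fun z _ => (hf z).continuousAt.continuousWithinAt)
      (fun z _ => (hf z).hasDerivWithinAt) hfx.le (fun z => hasDerivAt_const z 0)
      (fun z hz h0 => hneg z ⟨hx.1.trans hz.1, hz.2.le.trans hy.2⟩ h0)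
  have := (hf y).nonneg_of_le_left (lt_of_le_of_ne hxy hne)
    (fun z hz => by simpa [hfy] using hle ⟨hz.1.le, hz.2.le⟩)
  exact absurd (hneg y hy hfy) (not_lt.2 this)

/-- A degenerate binary quadratic form that pairs nonnegatively with a positive definite one is
positive semidefinite. -/
lemma degenerate_form_nonneg {c e m p q r : ℝ} (hp : 0 < p) (hpr : 0 < p * r - q ^ 2)
    (hdisc : e ^ 2 = 4 * c * m) (hpair : 0 ≤ r * c + p * m - q * e) (s t : ℝ) :
    0 ≤ c * s ^ 2 + e * s * t + m * t ^ 2 := by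
  have hr : 0 < r := by
    by_contra! hr
    nlinarith [sq_nonneg q, mul_nonneg hp.le (neg_nonneg.2 hr)]
  have hc : 0 ≤ c := by
    by_contra! hc
    have h1 : p * (c * (r * c + p * m - q * e)) = (p * e / 2 - q * c) ^ 2
        + (p * r - q ^ 2) * c ^ 2 := by linear_combination (-p ^ 2 / 4) * hdisc
    have h2 : 0 < (p * r - q ^ 2) * c ^ 2 := mul_pos hpr (sq_pos_of_neg hc)
    have h3 : p * (c * (r * c + p * m - q * e)) ≤ 0 :=
      mul_nonpos_of_nonneg_of_nonpos hp.le (mul_nonpos_of_nonpos_of_nonneg hc.le hpair)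
    nlinarith [sq_nonneg (p * e / 2 - q * c)]
  have hm : 0 ≤ m := by
    by_contra! hm
    have h1 : r * (m * (r * c + p * m - q * e)) = (r * e / 2 - q * m) ^ 2
        + (p * r - q ^ 2) * m ^ 2 := by linear_combination (-r ^ 2 / 4) * hdisc
    have h2 : 0 < (p * r - q ^ 2) * m ^ 2 := mul_pos hpr (sq_pos_of_neg hm)
    have h3 : r * (m * (r * c + p * m - q * e)) ≤ 0 :=
      mul_nonpos_of_nonneg_of_nonpos hr.le (mul_nonpos_of_nonpos_of_nonneg hm.le hpair)
    nlinarith [sq_nonneg (r * e / 2 - q * m)]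
  rcases hc.eq_or_lt with rfl | hc
  · obtain rfl : e = 0 := by simpa using hdisc
    simpa using mul_nonneg hm (sq_nonneg t)
  · refine nonneg_of_mul_nonneg_right (a := c) ?_ hc
    have : c * (c * s ^ 2 + e * s * t + m * t ^ 2) = (c * s + e * t / 2) ^ 2 := by
      linear_combination (-t ^ 2 / 4) * hdisc
    rw [this]
    positivity

/-- If the unit vector `(s, t)` is an eigenvector of a matrix of determinant one and positive trace,
then the pairing of `(s, t)` with its image under a positive definite form is positive. -/
lemma pairing_pos_of_eigenvector {a b c d p q r s t : ℝ} (hp : 0 < p) (hpr : 0 < p * r - q ^ 2)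
    (hdet : a * d - b * c = 1) (htr : 0 < a + d) (hst : s ^ 2 + t ^ 2 = 1)
    (heig : c * s ^ 2 + (d - a) * s * t + -b * t ^ 2 = 0) :
    0 < s * (p * (a * s + b * t) + q * (c * s + d * t))
      + t * (q * (a * s + b * t) + r * (c * s + d * t)) := by
  obtain ⟨k, hk⟩ : ∃ k, k = s * (a * s + b * t) + t * (c * s + d * t) := ⟨_, rfl⟩
  have h1 : a * s + b * t = k * s := by
    rw [hk]; linear_combination (-(a * s + b * t)) * hst - t * heig
  have h2 : c * s + d * t = k * t := by
    rw [hk]; linear_combination (-(c * s + d * t)) * hst + s * heig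
  have hchar : k * (a + d) = k ^ 2 + 1 := by
    have e1 : ((a - k) * (d - k) - b * c) * s = 0 := by
      linear_combination (d - k) * h1 - b * h2
    have e2 : ((a - k) * (d - k) - b * c) * t = 0 := by
      linear_combination (a - k) * h2 - c * h1
    linear_combination ((a - k) * (d - k) - b * c) * hst - s * e1 - t * e2 + hdet
  have hk0 : 0 < k := pos_of_mul_pos_left (by rw [hchar]; positivity) htr.le
  rw [h1, h2]
  have hq : 0 < p * s ^ 2 + 2 * q * s * t + r * t ^ 2 := by
    refine pos_of_mul_pos_right (a := p) ?_ hp.le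
    have e : p * (p * s ^ 2 + 2 * q * s * t + r * t ^ 2)
        = (p * s + q * t) ^ 2 + (p * r - q ^ 2) * t ^ 2 := by ring
    rw [e]
    rcases eq_or_ne t 0 with rfl | ht
    · have : 0 < s ^ 2 := by linarith
      have := mul_pos (pow_pos hp 2) this
      linarith [mul_pow p s 2]
    · positivity
  calc 0 < k * (p * s ^ 2 + 2 * q * s * t + r * t ^ 2) := mul_pos hk0 hq
    _ = _ := by ring

/-- The coordinate form of the gap statement, for trace at least two. -/
lemma existsUnique_root_of_two_lt_trace {l u : ℝ} (hlu : l < u) {a b c d p q r : ℝ → ℝ}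
    (hp : ∀ x ∈ Set.Icc l u, 0 < p x) (hpr : ∀ x ∈ Set.Icc l u, 0 < p x * r x - q x ^ 2)
    {a' b' c' d' : ℝ → ℝ}
    (ha : ∀ x, HasDerivAt a (a' x) x) (hb : ∀ x, HasDerivAt b (b' x) x)
    (hc : ∀ x, HasDerivAt c (c' x) x) (hd : ∀ x, HasDerivAt d (d' x) x)
    (ha' : ∀ x ∈ Set.Icc l u, a' x = q x * a x + r x * c x)
    (hb' : ∀ x ∈ Set.Icc l u, b' x = q x * b x + r x * d x)
    (hc' : ∀ x ∈ Set.Icc l u, c' x = -(p x * a x + q x * c x))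
    (hd' : ∀ x ∈ Set.Icc l u, d' x = -(p x * b x + q x * d x))
    (hdet : a l * d l - b l * c l = 1)
    (hgap : ∀ x ∈ Set.Ioo l u, 2 < a x + d x) (hlo : a l + d l = 2) (hhi : a u + d u = 2)
    {s t : ℝ} (hst : s ^ 2 + t ^ 2 = 1) :
    ∃! x, x ∈ Set.Icc l u ∧ c x * s ^ 2 + (d x - a x) * s * t + -b x * t ^ 2 = 0 := by
  have hdet' : ∀ x ∈ Set.Icc l u, a x * d x - b x * c x = 1 := by
    have hder : ∀ x, HasDerivAt (fun x => a x * d x - b x * c x)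
        (a' x * d x + a x * d' x - (b' x * c x + b x * c' x)) x :=
      fun x => ((ha x).mul (hd x)).sub ((hb x).mul (hc x))
    intro x hx
    rw [← hdet]
    refine constant_of_has_deriv_right_zero
      (fun z _ => (hder z).continuousAt.continuousWithinAt) (fun z hz => ?_) x hx
    have hz' : z ∈ Set.Icc l u := ⟨hz.1, hz.2.le⟩
    convert (hder z).hasDerivWithinAt using 1
    rw [ha' z hz', hb' z hz', hc' z hz', hd' z hz']
    ring
  have htr : ∀ x ∈ Set.Icc l u, 0 < a x + d x := by
    intro x hx
    rcases hx.1.eq_or_lt with rfl | h1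
    · linarith
    rcases hx.2.eq_or_lt with rfl | h2
    · linarith
    linarith [hgap x ⟨h1, h2⟩]
  have hl : l ∈ Set.Icc l u := Set.left_mem_Icc.2 hlu.le
  have hu : u ∈ Set.Icc l u := Set.right_mem_Icc.2 hlu.le
  have hf : ∀ x, HasDerivAt (fun x => c x * s ^ 2 + (d x - a x) * s * t + -b x * t ^ 2)
      (c' x * s ^ 2 + (d' x - a' x) * s * t + -b' x * t ^ 2) x := fun x =>
    (((hc x).mul_const _).add ((((hd x).sub (ha x)).mul_const s).mul_const t)).add
      ((hb x).neg.mul_const _)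
  have hlow : 0 ≤ c l * s ^ 2 + (d l - a l) * s * t + -b l * t ^ 2 := by
    refine degenerate_form_nonneg (hp l hl) (hpr l hl) ?_ ?_ s t
    · linear_combination (a l + d l + 2) * hlo - 4 * hdet
    · have := ((ha l).add (hd l)).nonneg_of_le_right hlu
        (fun z hz => by simpa [hlo] using (hgap z hz).le)
      rw [ha' l hl, hd' l hl] at this
      linarith
  have hhigh : 0 ≤ -c u * s ^ 2 + -(d u - a u) * s * t + b u * t ^ 2 := by
    refine degenerate_form_nonneg (hp u hu) (hpr u hu) ?_ ?_ s t
    · linear_combination (a u + d u + 2) * hhi - 4 * hdet' u hu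
    · have := ((ha u).add (hd u)).neg.nonneg_of_le_left hlu
        (fun z hz => by
          have := hgap z hz
          simp only [Pi.neg_apply, Pi.add_apply]
          linarith)
      rw [ha' u hu, hd' u hu] at this
      linarith
  obtain ⟨x, hx, hx0⟩ := intermediate_value_Icc' hlu.le
    (fun z _ => (hf z).continuousAt.continuousWithinAt) ⟨by linarith, hlow⟩
  refine ⟨x, ⟨hx, hx0⟩, fun y hy => eq_of_zeros_of_deriv_neg hf ?_ hy.1 hx hy.2 hx0⟩
  intro z hz hz0
  have := pairing_pos_of_eigenvector (hp z hz) (hpr z hz) (hdet' z hz) (htr z hz) hst hz0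
  rw [ha' z hz, hb' z hz, hc' z hz, hd' z hz]
  linarith

/-- A continuous function whose square equals four at the ends of an interval and exceeds four
inside has constant sign. -/
lemma const_sign_of_four_lt_sq {f : ℝ → ℝ} {l u : ℝ} (hlu : l < u) (hf : Continuous f)
    (hgap : ∀ x ∈ Set.Ioo l u, f x ^ 2 > 4) (hlo : f l ^ 2 = 4) (hhi : f u ^ 2 = 4) :
    (f l = 2 ∧ f u = 2 ∧ ∀ x ∈ Set.Ioo l u, 2 < f x) ∨
      (f l = -2 ∧ f u = -2 ∧ ∀ x ∈ Set.Ioo l u, f x < -2) := by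
  have hne : ∀ x ∈ Set.Icc l u, f x ≠ 0 := by
    intro x hx h0
    rcases hx.1.eq_or_lt with rfl | h1
    · norm_num [h0] at hlo
    rcases hx.2.eq_or_lt with rfl | h2
    · norm_num [h0] at hhi
    have := hgap x ⟨h1, h2⟩
    norm_num [h0] at this
  have hl : l ∈ Set.Icc l u := Set.left_mem_Icc.2 hlu.le
  have hu : u ∈ Set.Icc l u := Set.right_mem_Icc.2 hlu.le
  have hsign : (∀ x ∈ Set.Icc l u, 0 < f x) ∨ ∀ x ∈ Set.Icc l u, f x < 0 := by
    by_contra! h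
    obtain ⟨⟨x, hx, hx0⟩, y, hy, hy0⟩ := h
    obtain ⟨z, hz, hz0⟩ := isPreconnected_Icc.intermediate_value hx hy hf.continuousOn
      ⟨hx0, hy0⟩
    exact hne z hz hz0
  rcases hsign with h | h
  · left
    refine ⟨by nlinarith [h l hl], by nlinarith [h u hu], fun x hx => ?_⟩
    nlinarith [h x ⟨hx.1.le, hx.2.le⟩, hgap x hx]
  · right
    refine ⟨by nlinarith [h l hl], by nlinarith [h u hu], fun x hx => ?_⟩
    nlinarith [h x ⟨hx.1.le, hx.2.le⟩, hgap x hx]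

/-- If `(x_low, x_high)` is a gap in `x` of the solution `N` of `N' = J H N`
(with `H` continuous, symmetric and positive definite on `[x_low, x_high]`, and
`N x_low` symplectic), i.e. `(trace N x)² > 4` on the open interval and `= 4` at the
endpoints, then for every unit vector `v` the equation `⟨v, J (N x · v)⟩ = 0` has exactly
one root `x ∈ [x_low, x_high]`. -/
theorem unique_root_in_x_gap (xlow xhigh : ℝ) (hlt : xlow < xhigh)
    (H : ℝ → Matrix (Fin 2) (Fin 2) ℝ)
    (hHc : Continuous H)
    (hH : ∀ x ∈ Set.Icc xlow xhigh, (H x).IsSymm ∧ (H x).PosDef)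
    (N : ℝ → Matrix (Fin 2) (Fin 2) ℝ)
    (hN : ∀ x, HasDerivAt N (Jmat * H x * N x) x)
    (hsymp : (N xlow)ᵀ * Jmat * N xlow = Jmat)
    (hgap : ∀ x ∈ Set.Ioo xlow xhigh, (N x).trace ^ 2 > 4)
    (hlo : (N xlow).trace ^ 2 = 4) (hhi : (N xhigh).trace ^ 2 = 4) :
    ∀ v : Fin 2 → ℝ, v ⬝ᵥ v = 1 →
      ∃! x, x ∈ Set.Icc xlow xhigh ∧ v ⬝ᵥ Jmat.mulVec ((N x).mulVec v) = 0 := by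
  intro v hv
  have hst : v 0 ^ 2 + v 1 ^ 2 = 1 := by
    rw [← hv]; simp [dotProduct, Fin.sum_univ_two]; ring
  have hentry : ∀ i j x, HasDerivAt (fun x => N x i j) ((Jmat * H x * N x) i j) x :=
    fun i j x => hasDerivAt_pi.1 (hasDerivAt_pi.1 (hN x) i) j
  have hsymm : ∀ x ∈ Set.Icc xlow xhigh, H x 1 0 = H x 0 1 := fun x hx => (hH x hx).1.apply 0 1
  have hp : ∀ x ∈ Set.Icc xlow xhigh, 0 < H x 0 0 := fun x hx => (hH x hx).2.diag_pos
  have hpr : ∀ x ∈ Set.Icc xlow xhigh, 0 < H x 0 0 * H x 1 1 - H x 0 1 ^ 2 := by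
    intro x hx
    have h := (hH x hx).2.det_pos
    rw [Matrix.det_fin_two, hsymm x hx] at h
    linarith
  have hprod : ∀ x, (Jmat * H x * N x) 0 0 = H x 1 0 * N x 0 0 + H x 1 1 * N x 1 0 ∧
      (Jmat * H x * N x) 0 1 = H x 1 0 * N x 0 1 + H x 1 1 * N x 1 1 ∧
      (Jmat * H x * N x) 1 0 = -(H x 0 0 * N x 0 0 + H x 0 1 * N x 1 0) ∧
      (Jmat * H x * N x) 1 1 = -(H x 0 0 * N x 0 1 + H x 0 1 * N x 1 1) := by
    intro x
    simp [add_comm, Jmat, Matrix.mul_apply, Matrix.vecMul, dotProduct, Fin.sum_univ_two]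
  have hdet : N xlow 0 0 * N xlow 1 1 - N xlow 0 1 * N xlow 1 0 = 1 := by
    have h := congrFun (congrFun hsymp 0) 1
    simp [Jmat, Matrix.mul_apply, Fin.sum_univ_two] at h
    linarith
  have hform : ∀ x, v ⬝ᵥ Jmat.mulVec ((N x).mulVec v)
      = N x 1 0 * v 0 ^ 2 + (N x 1 1 - N x 0 0) * v 0 * v 1 + -N x 0 1 * v 1 ^ 2 := by
    intro x
    simp [Jmat, dotProduct, Matrix.mulVec, Fin.sum_univ_two]
    ring
  simp only [hform]
  simp only [Matrix.trace_fin_two] at hgap hlo hhi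
  have hcont : Continuous fun x => N x 0 0 + N x 1 1 :=
    continuous_iff_continuousAt.2
      fun x => (hentry 0 0 x).continuousAt.add (hentry 1 1 x).continuousAt
  rcases const_sign_of_four_lt_sq hlt hcont hgap hlo hhi with ⟨h1, h2, h3⟩ | ⟨h1, h2, h3⟩
  · exact existsUnique_root_of_two_lt_trace hlt hp hpr
      (hentry 0 0) (hentry 0 1) (hentry 1 0) (hentry 1 1)
      (fun x hx => by rw [(hprod x).1, hsymm x hx])
      (fun x hx => by rw [(hprod x).2.1, hsymm x hx])
      (fun x _ => (hprod x).2.2.1) (fun x _ => (hprod x).2.2.2) hdet h3 h1 h2 hst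
  · have h := existsUnique_root_of_two_lt_trace hlt hp hpr
      (fun x => (hentry 0 0 x).fun_neg) (fun x => (hentry 0 1 x).fun_neg)
      (fun x => (hentry 1 0 x).fun_neg) (fun x => (hentry 1 1 x).fun_neg)
      (fun x hx => by rw [(hprod x).1, hsymm x hx]; ring)
      (fun x hx => by rw [(hprod x).2.1, hsymm x hx]; ring)
      (fun x _ => by rw [(hprod x).2.2.1]; ring) (fun x _ => by rw [(hprod x).2.2.2]; ring)
      (by linarith) (fun x hx => by linarith [h3 x hx]) (by linarith) (by linarith) hst
    refine (existsUnique_congr fun x => and_congr_right fun _ => ?_).1 h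
    constructor <;> intro h0 <;> linarith
end
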